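/- Let S be a set of 12 distinct points of P² such that: no line contains 5 or more points of S; no conic (irreducible or reducible) contains 8 or more points of S; no (possibly reducible) cubic curve contains 11 or more points of S; no irreducible cubic curve contains 10 or more points of S; and some (necessarily reducible) cubic curve contains exactly 10 points of S. Then there exist an integer d with 3 ≤ d ≤ 6 and nonzero homogeneous polynomials P, Q ∈ ℂ[X,Y,Z] of degree d, having no common nonconstant factor in ℂ[X,Y,Z], such that Σ_{x ∈ S} min(ord_x(P), ord_x(Q)) ≥ 3d, where ord_x denotes the vanishing order at x. -/

import Mathlib

open MvPolynomial

/-- The iterated partial derivative of `F` corresponding to the multi-index `m`. -/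
noncomputable def pderivMulti (m : Fin 3 → ℕ) (F : MvPolynomial (Fin 3) ℂ) :
    MvPolynomial (Fin 3) ℂ :=
  (fun G => pderiv (0 : Fin 3) G)^[m 0]
    ((fun G => pderiv (1 : Fin 3) G)^[m 1]
      ((fun G => pderiv (2 : Fin 3) G)^[m 2] F))

/-- The vanishing order of `F` at a point `x` of the projective plane: the largest `k`
such that all partial derivatives of `F` of total order `< k` vanish at `x`. -/
noncomputable def ordAt (F : MvPolynomial (Fin 3) ℂ)
    (x : Projectivization ℂ (Fin 3 → ℂ)) : ℕ :=
  sSup {k : ℕ | ∀ m : Fin 3 → ℕ, m 0 + m 1 + m 2 < k →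
    eval x.rep (pderivMulti m F) = 0}

/-- Points of the projective plane. -/
abbrev P2 := Projectivization ℂ (Fin 3 → ℂ)

/-- Ternary polynomials. -/
abbrev Poly3 := MvPolynomial (Fin 3) ℂ

/-! ### Vanishing order -/

lemma pderiv_swap (i j : Fin 3) (F : Poly3) :
    pderiv i (pderiv j F) = pderiv j (pderiv i F) := by
  have h : ⁅pderiv (R := ℂ) i, pderiv j⁆ = (0 : Derivation ℂ Poly3 Poly3) := by
    apply MvPolynomial.derivation_ext
    intro k
    rw [Derivation.commutator_apply]
    simp [pderiv_X, Pi.single_apply]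
    split_ifs <;> simp
  have := congrArg (fun D => D F) h
  simp only [Derivation.commutator_apply] at this
  exact sub_eq_zero.1 this

lemma pderiv_iter_swap (i j : Fin 3) (n : ℕ) (F : Poly3) :
    (fun G => pderiv j G)^[n] (pderiv i F) = pderiv i ((fun G => pderiv j G)^[n] F) := by
  exact (Function.Commute.iterate_left (f := fun G : Poly3 => pderiv j G)
    (g := fun G : Poly3 => pderiv i G) (fun G => pderiv_swap j i G) n) F

lemma pderivMulti_pderiv (i : Fin 3) (m : Fin 3 → ℕ) (F : Poly3) :
    ∃ m', pderivMulti m (pderiv i F) = pderivMulti m' F := by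
  refine ⟨Function.update m i (m i + 1), ?_⟩
  unfold pderivMulti
  fin_cases i <;>
    simp [Function.update, pderiv_iter_swap, Function.iterate_succ', -Function.iterate_succ]

lemma exists_pderivMulti_ne (x : Fin 3 → ℂ) (n : ℕ) (F : Poly3) (hF : F ≠ 0)
    (hn : F.IsHomogeneous n) : ∃ m, eval x (pderivMulti m F) ≠ 0 := by
  induction n generalizing F with
  | zero =>
    refine ⟨0, ?_⟩
    have h0 := (totalDegree_eq_zero_iff_eq_C).1 (hn.totalDegree hF)
    simp only [pderivMulti, Pi.zero_apply, Function.iterate_zero, id]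
    rw [h0] at hF ⊢
    simpa using hF
  | succ n ih =>
    obtain ⟨i, hi⟩ : ∃ i, pderiv i F ≠ 0 := by
      by_contra! h
      have := hn.sum_X_mul_pderiv
      simp only [h, mul_zero, Finset.sum_const_zero] at this
      have h2 := smul_eq_zero.1 this.symm
      simp [hF] at h2
    obtain ⟨m, hm⟩ := ih _ hi (by simpa using hn.pderiv (i := i))
    obtain ⟨m', hm'⟩ := pderivMulti_pderiv i m F
    exact ⟨m', hm' ▸ hm⟩

lemma one_le_ordAt (x : P2) (n : ℕ) (F : Poly3) (hF : F ≠ 0)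
    (hn : F.IsHomogeneous n) (hx : eval x.rep F = 0) : 1 ≤ ordAt F x := by
  obtain ⟨m, hm⟩ := exists_pderivMulti_ne x.rep n F hF hn
  apply le_csSup
  · refine ⟨m 0 + m 1 + m 2, fun k hk => ?_⟩
    by_contra! h
    exact hm (hk m h)
  · intro m' hm'
    have h0 : m' 0 = 0 := by omega
    have h1 : m' 1 = 0 := by omega
    have h2 : m' 2 = 0 := by omega
    simpa [pderivMulti, h0, h1, h2] using hx

/-! ### Factors of homogeneous polynomials are homogeneous -/

/-- The substitution `X i ↦ T * X i`. -/
noncomputable def gradeHom : Poly3 →ₐ[ℂ] Polynomial Poly3 :=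
  aeval (fun i => Polynomial.monomial 1 (X i))

lemma gradeHom_monomial (s : Fin 3 →₀ ℕ) (c : ℂ) :
    gradeHom (monomial s c) = Polynomial.monomial s.degree (monomial s c) := by
  rw [gradeHom, aeval_monomial, monomial_eq, Finsupp.prod, Finsupp.prod]
  simp only [Polynomial.monomial_pow, one_mul]
  have : ∀ t : Finset (Fin 3), ∏ i ∈ t, Polynomial.monomial (s i) ((X i : Poly3) ^ s i)
      = Polynomial.monomial (∑ i ∈ t, s i) (∏ i ∈ t, (X i : Poly3) ^ s i) := by
    intro t
    induction t using Finset.induction_on with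
    | empty => simp
    | insert a t ha ih => rw [Finset.prod_insert ha, Finset.prod_insert ha, Finset.sum_insert ha,
        ih, Polynomial.monomial_mul_monomial]
  rw [this, IsScalarTower.algebraMap_apply ℂ Poly3 (Polynomial Poly3), Polynomial.algebraMap_eq,
    Polynomial.C_mul_monomial]
  rfl

lemma coeff_gradeHom (F : Poly3) (n : ℕ) :
    (gradeHom F).coeff n = homogeneousComponent n F := by
  induction F using MvPolynomial.monomial_add_induction_on with
  | C a =>
    rw [show (C a : Poly3) = monomial 0 a from rfl, gradeHom_monomial, Polynomial.coeff_monomial]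
    ext d
    rw [coeff_homogeneousComponent]
    split_ifs <;> simp_all [coeff_monomial] <;> grind
  | monomial_add s a F _ _ ih =>
    rw [map_add, map_add, Polynomial.coeff_add, ih, gradeHom_monomial, Polynomial.coeff_monomial]
    congr 1
    ext d
    rw [coeff_homogeneousComponent]
    split_ifs <;> simp_all [coeff_monomial] <;> grind

lemma gradeHom_ne {F : Poly3} (hF : F ≠ 0) : gradeHom F ≠ 0 := by
  intro h
  apply hF
  rw [← sum_homogeneousComponent F]
  apply Finset.sum_eq_zero
  intro i _
  rw [← coeff_gradeHom, h, Polynomial.coeff_zero]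

lemma isHomogeneous_of_gradeHom {F : Poly3} (h : (gradeHom F).natTrailingDegree = (gradeHom F).natDegree) :
    F.IsHomogeneous (gradeHom F).natDegree := by
  rw [← sum_homogeneousComponent F]
  apply IsHomogeneous.sum
  intro i _
  rw [sum_homogeneousComponent F]
  by_cases hi : i = (gradeHom F).natDegree
  · rw [← hi]; exact homogeneousComponent_isHomogeneous _ _
  · rw [← coeff_gradeHom]
    rcases lt_or_gt_of_ne hi with h1 | h1
    · rw [Polynomial.coeff_eq_zero_of_lt_natTrailingDegree (h ▸ h1)]; exact isHomogeneous_zero _ _ _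
    · rw [Polynomial.coeff_eq_zero_of_natDegree_lt h1]; exact isHomogeneous_zero _ _ _

lemma gradeHom_of_isHomogeneous {F : Poly3} {n : ℕ} (h : F.IsHomogeneous n) :
    gradeHom F = Polynomial.monomial n F := by
  ext1 k
  rw [coeff_gradeHom, Polynomial.coeff_monomial, homogeneousComponent_of_mem h]
  simp only [eq_comm]

lemma homog_of_mul {F G : Poly3} {n : ℕ} (hF : F ≠ 0) (hG : G ≠ 0) (h : (F * G).IsHomogeneous n) :
    ∃ a b, a + b = n ∧ F.IsHomogeneous a ∧ G.IsHomogeneous b := by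
  have h1 := gradeHom_of_isHomogeneous h
  rw [map_mul] at h1
  have h2 := congrArg Polynomial.natDegree h1
  have h3 := congrArg Polynomial.natTrailingDegree h1
  rw [Polynomial.natDegree_mul (gradeHom_ne hF) (gradeHom_ne hG),
    Polynomial.natDegree_monomial_eq _ (mul_ne_zero hF hG)] at h2
  rw [Polynomial.natTrailingDegree_mul (gradeHom_ne hF) (gradeHom_ne hG),
    Polynomial.natTrailingDegree_monomial (mul_ne_zero hF hG)] at h3
  have h4 := Polynomial.natTrailingDegree_le_natDegree (gradeHom F)
  have h5 := Polynomial.natTrailingDegree_le_natDegree (gradeHom G)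
  exact ⟨_, _, h2, isHomogeneous_of_gradeHom (by omega), isHomogeneous_of_gradeHom (by omega)⟩

/-! ### Evaluation on lines -/

lemma eval_smul_homog {F : Poly3} {n : ℕ} (h : F.IsHomogeneous n) (c : ℂ) (v : Fin 3 → ℂ) :
    eval (c • v) F = c ^ n * eval v F := by
  rw [eval_eq, eval_eq, Finset.mul_sum]
  apply Finset.sum_congr rfl
  intro d hd
  have h1 : ∏ i ∈ d.support, (c • v) i ^ d i
      = (∏ i ∈ d.support, c ^ d i) * ∏ i ∈ d.support, v i ^ d i := by
    rw [← Finset.prod_mul_distrib]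
    apply Finset.prod_congr rfl
    intro i _
    simp [mul_pow]
  rw [h1, Finset.prod_pow_eq_pow_sum, ← h.degree_eq_sum_deg_support hd]
  ring_nf

lemma eval_rep_mk {F : Poly3} {n : ℕ} (h : F.IsHomogeneous n) (v : Fin 3 → ℂ) (hv : v ≠ 0) :
    eval (Projectivization.mk ℂ v hv).rep F = 0 ↔ eval v F = 0 := by
  obtain ⟨a, ha⟩ := Projectivization.exists_smul_eq_mk_rep ℂ v hv
  rw [← ha, Units.smul_def, eval_smul_homog h]
  simp

lemma linear_form {l : Poly3} (hl : l.IsHomogeneous 1) :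
    ∃ c : Fin 3 → ℂ, l = ∑ i, c i • X i := by
  have : l ∈ homogeneousSubmodule (Fin 3) ℂ 1 := hl
  rw [homogeneousSubmodule_one_eq_span_X, Submodule.mem_span_range_iff_exists_fun] at this
  obtain ⟨c, hc⟩ := this
  exact ⟨c, hc.symm⟩

/-- A linear form as a linear functional. -/
noncomputable def linFun (c : Fin 3 → ℂ) : (Fin 3 → ℂ) →ₗ[ℂ] ℂ :=
  ∑ i, c i • LinearMap.proj i

lemma linFun_apply (c v : Fin 3 → ℂ) : linFun c v = eval v (∑ i, c i • X i : Poly3) := by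
  simp [linFun, smul_eval]

lemma finrank_ker_linFun {c : Fin 3 → ℂ} (hc : c ≠ 0) :
    Module.finrank ℂ (LinearMap.ker (linFun c)) = 2 := by
  have h1 := (linFun c).finrank_range_add_finrank_ker
  have h2 : LinearMap.range (linFun c) = ⊤ := by
    apply LinearMap.range_eq_top.2
    apply LinearMap.surjective
    intro h
    apply hc
    ext i
    have := congrArg (fun f => f (Pi.single i 1)) h
    simpa [linFun, Pi.single_apply] using this
  rw [h2] at h1
  simp at h1
  omega

lemma linear_form' {l : Poly3} (hl0 : l ≠ 0) (hl : l.IsHomogeneous 1) :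
    ∃ f : (Fin 3 → ℂ) →ₗ[ℂ] ℂ, (∀ v, f v = eval v l) ∧
      Module.finrank ℂ (LinearMap.ker f) = 2 := by
  obtain ⟨c, rfl⟩ := linear_form hl
  refine ⟨linFun c, linFun_apply c, finrank_ker_linFun ?_⟩
  rintro rfl
  simp at hl0

lemma exists_point_on_line {l : Poly3} (hl0 : l ≠ 0) (hl : l.IsHomogeneous 1) (T : Finset P2) :
    ∃ a : P2, a ∉ T ∧ eval a.rep l = 0 := by
  obtain ⟨f, hf, hk⟩ := linear_form' hl0 hl
  obtain ⟨u, hu⟩ : ∃ u : LinearMap.ker f, u ≠ 0 := by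
    have : Nontrivial (LinearMap.ker f) := Module.nontrivial_of_finrank_pos (R := ℂ) (by omega)
    exact exists_ne 0
  obtain ⟨v, hv⟩ := exists_linearIndependent_pair_of_one_lt_finrank (R := ℂ) (by omega) hu
  rw [LinearIndependent.pair_iff] at hv
  have hne : ∀ t : ℂ, (u : Fin 3 → ℂ) + t • (v : Fin 3 → ℂ) ≠ 0 := by
    intro t ht
    have := hv 1 t (by ext1; simpa using ht)
    simp at this
  let g : ℂ → P2 := fun t => Projectivization.mk ℂ _ (hne t)
  have hg : Function.Injective g := by
    intro s t hst
    obtain ⟨a, ha⟩ := (Projectivization.mk_eq_mk_iff' ℂ _ _ (hne s) (hne t)).1 hst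
    have := hv (a - 1) (a * t - s) (by
      ext1
      have : a • ((u : Fin 3 → ℂ) + t • (v : Fin 3 → ℂ)) - (u + s • v) = 0 := by rw [ha]; simp
      refine Eq.trans ?_ this
      push_cast
      module)
    have h1 : a = 1 := by linear_combination this.1
    have h2 := this.2
    rw [h1] at h2
    linear_combination -h2
  obtain ⟨a, ⟨t, rfl⟩, ha⟩ := (Set.infinite_range_of_injective hg).exists_notMem_finset T
  refine ⟨_, ha, ?_⟩
  rw [eval_rep_mk hl, ← hf]
  have h1 := u.2
  have h2 := v.2
  rw [LinearMap.mem_ker] at h1 h2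
  simp [h1, h2]

lemma eval_aeval_line (F : Poly3) (a b : Fin 3 → ℂ) (t : ℂ) :
    Polynomial.eval t (aeval (fun i => Polynomial.C (a i) + Polynomial.C (b i) * Polynomial.X) F)
      = eval (a + t • b) F := by
  rw [← Polynomial.coe_evalRingHom, aeval_def, hom_eval₂]
  have h1 : (Polynomial.evalRingHom t).comp (algebraMap ℂ (Polynomial ℂ)) = RingHom.id ℂ := by
    ext <;> simp
  rw [h1, ← eval₂_id]
  congr 1
  ext i
  simp only [Function.comp_apply, Polynomial.coe_evalRingHom, Polynomial.eval_add,
    Polynomial.eval_mul, Polynomial.eval_C, Polynomial.eval_X, Pi.add_apply, Pi.smul_apply,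
    smul_eq_mul]
  ring

lemma vanish_on_line {l F : Poly3} {n : ℕ} (hn : n ≠ 0) (hl0 : l ≠ 0) (hl : l.IsHomogeneous 1)
    (hF : F.IsHomogeneous n) (U : Finset P2) (hU : n < U.card) (hUl : ∀ x ∈ U, eval x.rep l = 0)
    (hUF : ∀ x ∈ U, eval x.rep F = 0) (b : Fin 3 → ℂ) (hb : eval b l = 0) : eval b F = 0 := by
  by_cases hb0 : b = 0
  · have := eval_smul_homog hF 0 b
    simpa [hn, hb0] using this
  by_cases hbU : Projectivization.mk ℂ b hb0 ∈ U
  · exact (eval_rep_mk hF b hb0).1 (hUF _ hbU)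
  obtain ⟨f, hf, hk⟩ := linear_form' hl0 hl
  obtain ⟨p0, hp0⟩ : U.Nonempty := Finset.card_pos.1 (by omega)
  have hnp : ∀ p ∈ U, ∀ c : ℂ, c • b ≠ p.rep := by
    intro p hp c hc
    apply hbU
    have : Projectivization.mk ℂ b hb0 = p := by
      rw [← Projectivization.mk_rep p, Projectivization.mk_eq_mk_iff']
      refine ⟨c⁻¹, ?_⟩
      have hc0 : c ≠ 0 := by rintro rfl; exact p.rep_nonzero (by simpa using hc.symm)
      rw [← hc, smul_smul, inv_mul_cancel₀ hc0, one_smul]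
    rwa [this]
  have hli : LinearIndependent ℂ ![b, p0.rep] := (LinearIndependent.pair_iff' hb0).2 (hnp p0 hp0)
  have hspan : Submodule.span ℂ {b, p0.rep} = LinearMap.ker f := by
    apply Submodule.eq_of_le_of_finrank_le
    · rw [Submodule.span_le]
      rintro x (rfl | rfl)
      · simpa [hf] using hb
      · simpa [hf] using hUl p0 hp0
    · have := finrank_span_eq_card hli
      rw [Matrix.range_cons_cons_empty] at this
      rw [hk, this]
      simp
  have hrep : ∀ p : P2, ∃ t : ℂ, p ∈ U → ∃ α : ℂ, α • (p0.rep + t • b) = p.rep := by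
    intro p
    by_cases hp : p ∈ U
    · have : p.rep ∈ LinearMap.ker f := by simpa [hf] using hUl p hp
      rw [← hspan, Submodule.mem_span_pair] at this
      obtain ⟨β, α, h⟩ := this
      have hα : α ≠ 0 := by
        rintro rfl
        exact hnp p hp β (by simpa using h)
      refine ⟨β / α, fun _ => ⟨α, ?_⟩⟩
      rw [← h, smul_add, smul_smul, mul_div_cancel₀ _ hα, add_comm]
    · exact ⟨0, fun h => absurd h hp⟩
  choose t ht using hrep
  have hinj : Set.InjOn t U := by
    intro p hp q hq hpq
    obtain ⟨α, hα⟩ := ht p hp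
    obtain ⟨α', hα'⟩ := ht q hq
    have h0 : α' ≠ 0 := by rintro rfl; exact q.rep_nonzero (by simpa using hα'.symm)
    rw [← Projectivization.mk_rep p, ← Projectivization.mk_rep q, Projectivization.mk_eq_mk_iff']
    refine ⟨α / α', ?_⟩
    rw [← hα, ← hα', hpq, smul_smul, div_mul_cancel₀ _ h0]
  have hg : (aeval (fun i => Polynomial.C (p0.rep i) + Polynomial.C (b i) * Polynomial.X) F
      : Polynomial ℂ) = 0 := by
    apply Polynomial.eq_zero_of_natDegree_lt_card_of_eval_eq_zero' _ (U.image t)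
    · intro s hs
      obtain ⟨p, hp, rfl⟩ := Finset.mem_image.1 hs
      obtain ⟨α, hα⟩ := ht p hp
      rw [eval_aeval_line]
      have h1 := hUF p hp
      rw [← hα, eval_smul_homog hF] at h1
      have h0 : α ≠ 0 := by rintro rfl; exact p.rep_nonzero (by simpa using hα.symm)
      simpa [h0] using h1
    · rw [Finset.card_image_of_injOn hinj]
      have := aeval_natDegree_le (n := 1) F hF.totalDegree_le
        (fun i => Polynomial.C (p0.rep i) + Polynomial.C (b i) * Polynomial.X) (by
          intro i
          compute_degree)
      omega
  have hall : ∀ s : ℂ, eval (p0.rep + s • b) F = 0 := by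
    intro s
    rw [← eval_aeval_line, hg, Polynomial.eval_zero]
  have hg2 : (aeval (fun i => Polynomial.C (b i) + Polynomial.C (p0.rep i) * Polynomial.X) F
      : Polynomial ℂ) = 0 := by
    apply Polynomial.eq_zero_of_infinite_isRoot
    apply Set.Infinite.mono _ (Set.finite_singleton (0 : ℂ)).infinite_compl
    intro s hs
    have hs : s ≠ 0 := by simpa using hs
    change Polynomial.eval s _ = 0
    rw [eval_aeval_line]
    have : b + s • p0.rep = s • (p0.rep + s⁻¹ • b) := by
      rw [smul_add, smul_smul, mul_inv_cancel₀ hs, one_smul, add_comm]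
    rw [this, eval_smul_homog hF, hall, mul_zero]
  have := eval_aeval_line F b p0.rep 0
  rw [hg2] at this
  simpa using this.symm

lemma dvd_of_vanish_hyperplane {l F : Poly3} (hl0 : l ≠ 0) (hl : l.IsHomogeneous 1)
    (h : ∀ v, eval v l = 0 → eval v F = 0) : l ∣ F := by
  obtain ⟨c, hc⟩ := linear_form hl
  obtain ⟨i, hi⟩ : ∃ i, c i ≠ 0 := by
    by_contra! h0
    apply hl0
    simp [hc, h0]
  let φ : Poly3 →ₐ[ℂ] Poly3 := aeval (fun j => X j - C (if j = i then (c i)⁻¹ else 0) * l)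
  have h1 : ∀ G : Poly3, l ∣ G - φ G := by
    intro G
    rw [← Ideal.mem_span_singleton, ← Ideal.Quotient.eq]
    have : (Ideal.Quotient.mkₐ ℂ (Ideal.span {l})) =
        (Ideal.Quotient.mkₐ ℂ (Ideal.span {l})).comp φ := by
      apply MvPolynomial.algHom_ext
      intro j
      simp only [AlgHom.comp_apply, Ideal.Quotient.mkₐ_eq_mk, φ, aeval_X]
      rw [Ideal.Quotient.eq, Ideal.mem_span_singleton]
      simp
    exact congrArg (fun f => f G) this
  have h2 : φ F = 0 := by
    apply MvPolynomial.funext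
    intro v
    have h3 : eval v (φ F) =
        eval (fun j => v j - (if j = i then (c i)⁻¹ else 0) * eval v l) F := by
      simp only [φ, aeval_def]
      rw [hom_eval₂]
      have : (eval v).comp (algebraMap ℂ Poly3) = RingHom.id ℂ := by ext <;> simp
      rw [this, ← eval₂_id]
      congr 1
      ext j
      simp
    rw [h3, map_zero]
    apply h
    have h4 : eval v l = ∑ j, c j * v j := by rw [hc]; simp [smul_eval]
    nth_rewrite 2 [hc]
    simp only [map_sum, smul_eval, eval_X, mul_sub, Finset.sum_sub_distrib, ← h4]
    simp [hi]
  have := h1 F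
  rwa [h2, sub_zero] at this

/-! ### Dimension of spaces of forms through given points -/

/-- Forms of degree `k` vanishing at all points of `T`. -/
def formsThrough (k : ℕ) (T : Finset P2) : Submodule ℂ Poly3 where
  carrier := {F | F.IsHomogeneous k ∧ ∀ x ∈ T, eval x.rep F = 0}
  add_mem' := by
    rintro F G ⟨h1, h2⟩ ⟨h3, h4⟩
    exact ⟨h1.add h3, fun x hx => by rw [map_add, h2 x hx, h4 x hx, add_zero]⟩
  zero_mem' := ⟨isHomogeneous_zero _ _ _, fun _ _ => map_zero _⟩
  smul_mem' := by
    rintro c F ⟨h1, h2⟩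
    exact ⟨(homogeneousSubmodule (Fin 3) ℂ k).smul_mem c h1,
      fun x hx => by rw [smul_eval, h2 x hx, mul_zero]⟩

lemma mem_formsThrough {k : ℕ} {T : Finset P2} {F : Poly3} :
    F ∈ formsThrough k T ↔ F.IsHomogeneous k ∧ ∀ x ∈ T, eval x.rep F = 0 := Iff.rfl

instance (k : ℕ) (T : Finset P2) : FiniteDimensional ℂ (formsThrough k T) := by
  have : FiniteDimensional ℂ (homogeneousSubmodule (Fin 3) ℂ k) :=
    Module.Finite.iff_fg.2 (homogeneousSubmodule_fg _ _ k)
  exact Submodule.finiteDimensional_of_le (S₂ := homogeneousSubmodule (Fin 3) ℂ k)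
    (fun F hF => hF.1)

/-- The dimension of the space of forms of degree `k` through `T`. -/
noncomputable def formsDim (k : ℕ) (T : Finset P2) : ℕ := Module.finrank ℂ (formsThrough k T)

open Classical in
lemma formsDim_insert (k : ℕ) (T : Finset P2) (a : P2) :
    formsDim k T ≤ formsDim k (insert a T) + 1 := by
  let φ : formsThrough k T →ₗ[ℂ] ℂ := (aeval a.rep : Poly3 →ₐ[ℂ] ℂ).toLinearMap.comp
    (formsThrough k T).subtype
  have h1 := φ.finrank_range_add_finrank_ker
  have h2 : Module.finrank ℂ (LinearMap.range φ) ≤ 1 := by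
    simpa using Submodule.finrank_le (LinearMap.range φ)
  have h3 : Module.finrank ℂ (LinearMap.ker φ) ≤ formsDim k (insert a T) := by
    rw [← Submodule.finrank_map_subtype_eq]
    apply Submodule.finrank_mono
    rintro F ⟨⟨G, hG⟩, hG2, rfl⟩
    refine ⟨hG.1, fun x hx => ?_⟩
    rcases Finset.mem_insert.1 hx with rfl | hx
    · simpa [φ, aeval_eq_eval] using hG2
    · exact hG.2 x hx
  unfold formsDim at *
  omega

lemma formsDim_card (k : ℕ) (T : Finset P2) :
    formsDim k ∅ ≤ formsDim k T + T.card := by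
  classical
  induction T using Finset.induction_on with
  | empty => simp
  | insert a T ha ih =>
    have := formsDim_insert k T a
    rw [Finset.card_insert_of_notMem ha]
    omega

/-- Exponents of degree `n`. -/
noncomputable def expo (n : ℕ) (p : {p : Fin (n + 1) × Fin (n + 1) // p.1.val + p.2.val ≤ n}) :
    Fin 3 →₀ ℕ :=
  Finsupp.equivFunOnFinite.symm ![p.1.1, p.1.2, n - (p.1.1 + p.1.2)]

lemma expo_injective (n : ℕ) : Function.Injective (expo n) := by
  rintro ⟨⟨a, b⟩, h⟩ ⟨⟨a', b'⟩, h'⟩ hp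
  have h0 := congrArg (fun f => f 0) hp
  have h1 := congrArg (fun f => f 1) hp
  simp only [expo, Finsupp.equivFunOnFinite_symm_apply_apply] at h0 h1
  simp at h0 h1
  ext
  · exact h0
  · exact h1

lemma formsDim_empty (n : ℕ) :
    Fintype.card {p : Fin (n + 1) × Fin (n + 1) // p.1.val + p.2.val ≤ n} ≤ formsDim n ∅ := by
  have h1 : LinearIndependent ℂ (fun p => (monomial (expo n p) (1 : ℂ) : Poly3)) := by
    have := (basisMonomials (Fin 3) ℂ).linearIndependent.comp _ (expo_injective n)
    simpa [Function.comp_def] using this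
  have h2 : ∀ p, (monomial (expo n p) (1 : ℂ) : Poly3) ∈ formsThrough n ∅ := by
    intro p
    refine ⟨isHomogeneous_monomial _ ?_, by simp⟩
    have := p.2
    rw [Finsupp.degree_eq_sum]
    simp [expo, Fin.sum_univ_three]
    omega
  have h3 : LinearIndependent ℂ (fun p => (⟨_, h2 p⟩ : formsThrough n ∅)) := by
    apply LinearIndependent.of_comp (formsThrough n ∅).subtype
    exact h1
  exact h3.fintype_card_le_finrank

lemma formsDim_one : 3 ≤ formsDim 1 ∅ := le_trans (by decide) (formsDim_empty 1)

lemma formsDim_four : 15 ≤ formsDim 4 ∅ := le_trans (by decide) (formsDim_empty 4)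

lemma formsDim_zero (T : Finset P2) : formsDim 0 T ≤ 1 := by
  have : formsThrough 0 T ≤ Submodule.span ℂ {(1 : Poly3)} := by
    intro F hF
    rw [Submodule.mem_span_singleton]
    refine ⟨coeff 0 F, ?_⟩
    have := totalDegree_eq_zero_iff_eq_C.1 (Nat.le_zero.1 hF.1.totalDegree_le)
    conv_rhs => rw [this]
    rw [smul_eq_C_mul, mul_one]
  exact (Submodule.finrank_mono this).trans (finrank_span_singleton one_ne_zero).le

lemma exists_form {k : ℕ} {T : Finset P2} (h : 1 ≤ formsDim k T) :
    ∃ F : Poly3, F ≠ 0 ∧ F.IsHomogeneous k ∧ ∀ x ∈ T, eval x.rep F = 0 := by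
  have : Nontrivial (formsThrough k T) := Module.nontrivial_of_finrank_pos (R := ℂ) h
  obtain ⟨F, hF⟩ := exists_ne (0 : formsThrough k T)
  exact ⟨F, fun h => hF (Subtype.ext h), F.2.1, F.2.2⟩

open Classical in
lemma formsDim_div {k e : ℕ} (T : Finset P2) {h : Poly3} (h0 : h ≠ 0) (he : h.IsHomogeneous e)
    (hdvd : ∀ F ∈ formsThrough (k + e) T, h ∣ F) :
    formsDim (k + e) T ≤ formsDim k (T.filter (fun x => eval x.rep h ≠ 0)) := by
  have : formsThrough (k + e) T ≤ (formsThrough k (T.filter (fun x => eval x.rep h ≠ 0))).map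
      (LinearMap.mulLeft ℂ h) := by
    intro F hF
    obtain ⟨G, rfl⟩ := hdvd F hF
    refine ⟨G, ⟨?_, ?_⟩, rfl⟩
    · by_cases hG : G = 0
      · rw [hG]; exact isHomogeneous_zero _ _ _
      obtain ⟨a, b, hab, ha, hb⟩ := homog_of_mul h0 hG hF.1
      have := ha.inj_right he h0
      have : b = k := by omega
      exact this ▸ hb
    · intro x hx
      rw [Finset.mem_filter] at hx
      have := hF.2 x hx.1
      rw [map_mul, mul_eq_zero] at this
      exact this.resolve_left hx.2
  exact (Submodule.finrank_mono this).trans (Submodule.finrank_map_le _ _)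

open Classical in
lemma formsDim_line (k : ℕ) {l : Poly3} (h0 : l ≠ 0) (hl : l.IsHomogeneous 1) (j : ℕ)
    (T : Finset P2) (hj : k + 2 ≤ (T.filter (fun x => eval x.rep l = 0)).card + j) :
    formsDim (k + 1) T ≤ formsDim k (T.filter (fun x => eval x.rep l ≠ 0)) + j := by
  induction j generalizing T with
  | zero =>
    apply formsDim_div T h0 hl
    intro F hF
    apply dvd_of_vanish_hyperplane h0 hl
    exact vanish_on_line (n := k + 1) (by omega) h0 hl hF.1
      (T.filter (fun x => eval x.rep l = 0)) (by omega)
      (fun x hx => (Finset.mem_filter.1 hx).2) (fun x hx => hF.2 x (Finset.mem_filter.1 hx).1)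
  | succ j ih =>
    obtain ⟨a, ha, hal⟩ := exists_point_on_line h0 hl T
    have h1 := formsDim_insert (k + 1) T a
    have h2 := ih (insert a T) (by
      rw [Finset.filter_insert, if_pos hal, Finset.card_insert_of_notMem (by simp [ha])]
      omega)
    rw [Finset.filter_insert, if_neg (by simp [hal])] at h2
    omega

lemma exists_line (a b : P2) :
    ∃ l : Poly3, l ≠ 0 ∧ l.IsHomogeneous 1 ∧ eval a.rep l = 0 ∧ eval b.rep l = 0 := by
  classical
  have h1 := formsDim_card 1 {a, b}
  have h2 := formsDim_one
  have h3 : ({a, b} : Finset P2).card ≤ 2 := Finset.card_le_two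
  obtain ⟨l, h0, hl, h⟩ := exists_form (k := 1) (T := {a, b}) (by omega)
  exact ⟨l, h0, hl, h a (by simp), h b (by simp)⟩

/-! ### Few points impose independent conditions -/

open Classical in
/-- The points of `T` on the curve `l = 0`. -/
noncomputable def onC (T : Finset P2) (l : Poly3) : Finset P2 :=
  T.filter (fun x => eval x.rep l = 0)

open Classical in
/-- The points of `T` off the curve `l = 0`. -/
noncomputable def offC (T : Finset P2) (l : Poly3) : Finset P2 :=
  T.filter (fun x => eval x.rep l ≠ 0)

lemma card_on_off (T : Finset P2) (l : Poly3) : (onC T l).card + (offC T l).card = T.card := by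
  classical
  exact Finset.card_filter_add_card_filter_not _

lemma mem_onC {T : Finset P2} {l : Poly3} {x : P2} :
    x ∈ onC T l ↔ x ∈ T ∧ eval x.rep l = 0 := by simp [onC]

lemma mem_offC {T : Finset P2} {l : Poly3} {x : P2} :
    x ∈ offC T l ↔ x ∈ T ∧ eval x.rep l ≠ 0 := by simp [offC]

lemma onC_mono {T U : Finset P2} (h : T ⊆ U) (l : Poly3) : (onC T l).card ≤ (onC U l).card := by
  apply Finset.card_le_card
  intro x hx
  rw [mem_onC] at hx ⊢
  exact ⟨h hx.1, hx.2⟩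

lemma offC_subset (T : Finset P2) (l : Poly3) : offC T l ⊆ T := fun _ hx => (mem_offC.1 hx).1

lemma dim_line (k : ℕ) {l : Poly3} (h0 : l ≠ 0) (hl : l.IsHomogeneous 1) (T : Finset P2) (j : ℕ)
    (hj : k + 2 ≤ (onC T l).card + j) {m : ℕ} (hm : m = k + 1) :
    formsDim m T ≤ formsDim k (offC T l) + j :=
  hm ▸ formsDim_line k h0 hl j T hj

lemma exists_secant {T : Finset P2} (h : 2 ≤ T.card) :
    ∃ l : Poly3, l ≠ 0 ∧ l.IsHomogeneous 1 ∧ 2 ≤ (onC T l).card := by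
  classical
  obtain ⟨a, ha, b, hb, hab⟩ := Finset.one_lt_card.1 h
  obtain ⟨l, h0, hl, h1, h2⟩ := exists_line a b
  refine ⟨l, h0, hl, ?_⟩
  rw [← Finset.card_pair hab]
  apply Finset.card_le_card
  intro x hx
  rw [mem_onC]
  rcases Finset.mem_insert.1 hx with rfl | hx
  · exact ⟨ha, h1⟩
  · rw [Finset.mem_singleton.1 hx]; exact ⟨hb, h2⟩

lemma lines_two {T : Finset P2} (h : 2 ≤ formsDim 1 T) : T.card ≤ 1 := by
  by_contra! hT
  obtain ⟨l, h0, hl, h2⟩ := exists_secant hT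
  have h3 := dim_line 0 h0 hl T 0 (by omega) (m := 1) rfl
  have h4 := formsDim_zero (offC T l)
  omega

lemma lines_three {T : Finset P2} (h : 3 ≤ formsDim 1 T) : T = ∅ := by
  by_contra hT
  obtain ⟨a, ha⟩ := Finset.nonempty_iff_ne_empty.2 hT
  obtain ⟨l, h0, hl, h1, -⟩ := exists_line a a
  have h2 : 0 < (onC T l).card := Finset.card_pos.2 ⟨a, mem_onC.2 ⟨ha, h1⟩⟩
  have h3 := dim_line 0 h0 hl T 1 (by omega) (m := 1) rfl
  have h4 := formsDim_zero (offC T l)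
  omega

lemma conics_three {U : Finset P2} (h : 3 ≤ formsDim 2 U) (hU : 4 ≤ U.card) :
    ∃ l : Poly3, l ≠ 0 ∧ l.IsHomogeneous 1 ∧ ∀ x ∈ U, eval x.rep l = 0 := by
  obtain ⟨l, h0, hl, h2⟩ := exists_secant (T := U) (by omega)
  have h3 := dim_line 1 h0 hl U 1 (by omega) (m := 2) rfl
  have h4 := lines_two (T := offC U l) (by omega)
  have h5 := card_on_off U l
  have h6 := dim_line 1 h0 hl U 0 (by omega) (m := 2) rfl
  have h7 := lines_three (T := offC U l) (by omega)
  refine ⟨l, h0, hl, fun x hx => ?_⟩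
  by_contra hx0
  have : x ∈ offC U l := mem_offC.2 ⟨hx, hx0⟩
  simp [h7] at this

lemma conics_two {U : Finset P2} (h : 2 ≤ formsDim 2 U) (hU : 5 ≤ U.card) :
    ∃ l : Poly3, l ≠ 0 ∧ l.IsHomogeneous 1 ∧ 4 ≤ (onC U l).card := by
  by_contra! hcon
  have hle : ∀ l : Poly3, l ≠ 0 → l.IsHomogeneous 1 → (onC U l).card ≤ 2 := by
    intro l h0 hl
    by_contra! h3
    have h4 := dim_line 1 h0 hl U 0 (by omega) (m := 2) rfl
    have h5 := lines_two (T := offC U l) (by omega)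
    have h6 := card_on_off U l
    have h7 := hcon l h0 hl
    omega
  obtain ⟨l, h0, hl, h2⟩ := exists_secant (T := U) (by omega)
  have h3 := dim_line 1 h0 hl U 1 (by omega) (m := 2) rfl
  obtain ⟨l', h0', hl', h4⟩ := exists_form (k := 1) (T := offC U l) (by omega)
  have h5 : (offC U l).card ≤ (onC U l').card := by
    apply Finset.card_le_card
    intro x hx
    exact mem_onC.2 ⟨offC_subset _ _ hx, h4 x hx⟩
  have h6 := card_on_off U l
  have h7 := hle l h0 hl
  have h8 := hle l' h0' hl'
  omega

lemma cubics_three {T : Finset P2} (h : 3 ≤ formsDim 3 T) (hT : 8 ≤ T.card)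
    (hline : ∀ l : Poly3, l ≠ 0 → l.IsHomogeneous 1 → (onC T l).card ≤ 4) :
    ∃ c : Poly3, c ≠ 0 ∧ c.IsHomogeneous 2 ∧ ∀ x ∈ T, eval x.rep c = 0 := by
  classical
  by_cases h4 : ∃ l : Poly3, l ≠ 0 ∧ l.IsHomogeneous 1 ∧ 4 ≤ (onC T l).card
  · obtain ⟨l, h0, hl, h4⟩ := h4
    have h5 := hline l h0 hl
    have h6 := card_on_off T l
    have h7 := dim_line 2 h0 hl T 0 (by omega) (m := 3) rfl
    obtain ⟨l', h0', hl', h8⟩ := conics_three (U := offC T l) (by omega) (by omega)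
    refine ⟨l * l', mul_ne_zero h0 h0', hl.mul hl', fun x hx => ?_⟩
    rw [map_mul]
    by_cases hx0 : eval x.rep l = 0
    · rw [hx0, zero_mul]
    · rw [h8 x (mem_offC.2 ⟨hx, hx0⟩), mul_zero]
  push Not at h4
  have hle : ∀ l : Poly3, l ≠ 0 → l.IsHomogeneous 1 → (onC T l).card ≤ 2 := by
    intro l h0 hl
    by_contra! h3
    have h5 := h4 l h0 hl
    have h6 := card_on_off T l
    have h7 := dim_line 2 h0 hl T 1 (by omega) (m := 3) rfl
    obtain ⟨l', h0', hl', h8⟩ := conics_two (U := offC T l) (by omega) (by omega)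
    have h9 := onC_mono (offC_subset T l) l'
    have := h4 l' h0' hl'
    omega
  -- every pair of points can be removed to leave points on a conic
  have hpair : ∀ a ∈ T, ∀ b ∈ T, a ≠ b → ∃ c : Poly3, c ≠ 0 ∧ c.IsHomogeneous 2 ∧
      ∀ x ∈ T, x ≠ a → x ≠ b → eval x.rep c = 0 := by
    intro a ha b hb hab
    obtain ⟨l, h0, hl, hla, hlb⟩ := exists_line a b
    have h5 : {a, b} ⊆ onC T l := by
      intro x hx
      rw [mem_onC]
      rcases Finset.mem_insert.1 hx with rfl | hx
      · exact ⟨ha, hla⟩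
      · rw [Finset.mem_singleton.1 hx]; exact ⟨hb, hlb⟩
    have h6 := Finset.card_pair hab
    have h7 : {a, b} = onC T l := Finset.eq_of_subset_of_card_le h5 (by rw [h6]; exact hle l h0 hl)
    have h8 := dim_line 2 h0 hl T 2 (by rw [← h7]; omega) (m := 3) rfl
    obtain ⟨c, hc0, hc, hcx⟩ := exists_form (k := 2) (T := offC T l) (by omega)
    refine ⟨c, hc0, hc, fun x hx hxa hxb => hcx x (mem_offC.2 ⟨hx, fun hx0 => ?_⟩)⟩
    have : x ∈ onC T l := mem_onC.2 ⟨hx, hx0⟩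
    rw [← h7] at this
    simp [hxa, hxb] at this
  obtain ⟨a, ha, b, hb, c, hc, hab, hac, hbc⟩ := Finset.two_lt_card.1 (show 2 < T.card by omega)
  let U := T.filter (fun x => x ≠ a ∧ x ≠ b ∧ x ≠ c)
  have hU : 5 ≤ U.card := by
    have h1 : T ⊆ insert a (insert b (insert c U)) := by
      intro x hx
      simp only [Finset.mem_insert, U, Finset.mem_filter]
      tauto
    have h2 := Finset.card_le_card h1
    have h3 := Finset.card_insert_le a (insert b (insert c U))
    have h4 := Finset.card_insert_le b (insert c U)
    have h5 := Finset.card_insert_le c U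
    omega
  have hU1 : formsDim 2 U ≤ 1 := by
    by_contra! h2
    obtain ⟨l, h0, hl, h3⟩ := conics_two h2 hU
    have h5 := onC_mono (T := U) (U := T) (Finset.filter_subset _ _) l
    have := hle l h0 hl
    omega
  obtain ⟨c1, h10, h11, h1⟩ := hpair a ha b hb hab
  obtain ⟨c2, h20, h21, h2⟩ := hpair a ha c hc hac
  obtain ⟨c3, h30, h31, h3⟩ := hpair b hb c hc hbc
  have m1 : c1 ∈ formsThrough 2 U := ⟨h11, fun x hx => by
    simp only [U, Finset.mem_filter] at hx; exact h1 x hx.1 hx.2.1 hx.2.2.1⟩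
  have m2 : c2 ∈ formsThrough 2 U := ⟨h21, fun x hx => by
    simp only [U, Finset.mem_filter] at hx; exact h2 x hx.1 hx.2.1 hx.2.2.2⟩
  have m3 : c3 ∈ formsThrough 2 U := ⟨h31, fun x hx => by
    simp only [U, Finset.mem_filter] at hx; exact h3 x hx.1 hx.2.2.1 hx.2.2.2⟩
  obtain ⟨v, hv⟩ := finrank_le_one_iff.1 hU1
  have key : ∀ p q : Poly3, p ≠ 0 → p ∈ formsThrough 2 U → q ∈ formsThrough 2 U → ∀ x : P2,
      eval x.rep p = 0 → eval x.rep q = 0 := by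
    intro p q hp0 hp hq x hx
    obtain ⟨s, hs⟩ := hv ⟨p, hp⟩
    obtain ⟨t, ht⟩ := hv ⟨q, hq⟩
    have hs' : s • (v : Poly3) = p := congrArg Subtype.val hs
    have ht' : t • (v : Poly3) = q := congrArg Subtype.val ht
    have hs0 : s ≠ 0 := by rintro rfl; exact hp0 (by simpa using hs'.symm)
    rw [← hs', smul_eval, mul_eq_zero] at hx
    rw [← ht', smul_eval, hx.resolve_left hs0, mul_zero]
  refine ⟨c1, h10, h11, fun x hx => ?_⟩
  by_cases hxa : x = a
  · subst hxa; exact key c3 c1 h30 m3 m1 _ (h3 x hx hab hac)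
  by_cases hxb : x = b
  · subst hxb; exact key c2 c1 h20 m2 m1 _ (h2 x hx hxa hbc)
  exact h1 x hx hxa hxb

/-! ### Main argument -/

lemma formsDim_quartic {S : Finset P2} (hS : S.card = 12) : 3 ≤ formsDim 4 S := by
  have h1 := formsDim_four
  have h2 := formsDim_card 4 S
  omega

lemma no_common_factor {S : Finset P2} (hS : S.card = 12)
    (hline : ∀ l : Poly3, l ≠ 0 → l.IsHomogeneous 1 → (onC S l).card ≤ 4)
    (hconic : ∀ l : Poly3, l ≠ 0 → l.IsHomogeneous 2 → (onC S l).card ≤ 7)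
    (hcubic : ∀ l : Poly3, l ≠ 0 → l.IsHomogeneous 3 → (onC S l).card ≤ 10)
    {h : Poly3} {e : ℕ} (h0 : h ≠ 0) (he : h.IsHomogeneous e) (he1 : 1 ≤ e) (he4 : e ≤ 4) :
    ∃ F ∈ formsThrough 4 S, ¬ h ∣ F := by
  by_contra! hcon
  have hdim := formsDim_quartic hS
  obtain ⟨k, hk⟩ : ∃ k, k + e = 4 := ⟨4 - e, by omega⟩
  have hdiv : formsDim (k + e) S ≤ formsDim k (offC S h) :=
    formsDim_div S h0 he (by rw [hk]; exact hcon)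
  rw [hk] at hdiv
  have hc := card_on_off S h
  have hmono := fun l => onC_mono (offC_subset S h) l
  interval_cases e
  · obtain rfl : k = 3 := by omega
    have h1 := hline h h0 he
    obtain ⟨c, hc0, hc2, hcx⟩ := cubics_three (T := offC S h) (by omega) (by omega)
      (fun l h0 hl => (hmono l).trans (hline l h0 hl))
    have h2 := hconic c hc0 hc2
    have h3 : (offC S h).card ≤ (onC S c).card := Finset.card_le_card
      (fun x hx => mem_onC.2 ⟨offC_subset _ _ hx, hcx x hx⟩)
    omega
  · obtain rfl : k = 2 := by omega
    have h1 := hconic h h0 he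
    obtain ⟨c, hc0, hc2, hcx⟩ := conics_three (U := offC S h) (by omega) (by omega)
    have h2 := hline c hc0 hc2
    have h3 : (offC S h).card ≤ (onC S c).card := Finset.card_le_card
      (fun x hx => mem_onC.2 ⟨offC_subset _ _ hx, hcx x hx⟩)
    omega
  · obtain rfl : k = 1 := by omega
    have h1 := hcubic h h0 he
    have h2 := lines_three (T := offC S h) (by omega)
    rw [h2, Finset.card_empty] at hc
    omega
  · obtain rfl : k = 0 := by omega
    have h2 := formsDim_zero (offC S h)
    omega

/-- The subspace of forms divisible by `f`. -/
def dvdSub (V : Submodule ℂ Poly3) (f : Poly3) : Submodule ℂ V where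
  carrier := {Q | f ∣ Q.1}
  add_mem' := fun h1 h2 => dvd_add h1 h2
  zero_mem' := dvd_zero f
  smul_mem' := fun c Q hQ => by
    change f ∣ c • Q.1
    rw [smul_eq_C_mul]
    exact Dvd.dvd.mul_left hQ _

lemma exists_coprime_pair {V : Submodule ℂ Poly3} {n : ℕ} (hV : ∀ F ∈ V, F.IsHomogeneous n)
    {P : Poly3} (hP : P ∈ V) (hP0 : P ≠ 0)
    (hfac : ∀ (h : Poly3) (e : ℕ), h ≠ 0 → h.IsHomogeneous e → 1 ≤ e → e ≤ n →
      ∃ F ∈ V, ¬ h ∣ F) :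
    ∃ Q ∈ V, ¬ ∃ h : Poly3, 0 < h.totalDegree ∧ h ∣ P ∧ h ∣ Q := by
  classical
  let fs : Finset Poly3 := (UniqueFactorizationMonoid.factors P).toFinset
  let s : Finset (Submodule ℂ V) := fs.image (dvdSub V)
  have htop : ⊤ ∉ s := by
    intro ht
    obtain ⟨f, hf, hft⟩ := Finset.mem_image.1 ht
    have hf' := Multiset.mem_toFinset.1 hf
    have hirr := UniqueFactorizationMonoid.irreducible_of_factor f hf'
    obtain ⟨g, hg⟩ := UniqueFactorizationMonoid.dvd_of_mem_factors hf'
    have hg0 : g ≠ 0 := by rintro rfl; exact hP0 (by simpa using hg)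
    have hhom := hV P hP
    rw [hg] at hhom
    obtain ⟨a, b, hab, ha, hb⟩ := homog_of_mul hirr.ne_zero hg0 hhom
    have ha1 : 1 ≤ a := by
      by_contra! h
      obtain rfl : a = 0 := by omega
      have h1 := totalDegree_eq_zero_iff_eq_C.1 (Nat.le_zero.1 ha.totalDegree_le)
      apply hirr.not_isUnit
      rw [h1, isUnit_map_iff, isUnit_iff_ne_zero]
      intro h2
      rw [h2, map_zero] at h1
      exact hirr.ne_zero h1
    obtain ⟨F, hF, hFn⟩ := hfac f a hirr.ne_zero ha ha1 (by omega)
    have : (⟨F, hF⟩ : V) ∈ dvdSub V f := by rw [hft]; trivial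
    exact hFn this
  have hne := Subspace.biUnion_ne_univ_of_top_notMem htop
  obtain ⟨Q, hQ⟩ := (Set.ne_univ_iff_exists_notMem _).1 hne
  refine ⟨Q, Q.2, ?_⟩
  rintro ⟨h, hdeg, hhP, hhQ⟩
  have h0 : h ≠ 0 := by rintro rfl; simp at hdeg
  have hu : ¬ IsUnit h := by
    intro hu
    have := MvPolynomial.isUnit_iff_totalDegree_of_isReduced.1 hu
    omega
  obtain ⟨f, hfirr, hfh⟩ := WfDvdMonoid.exists_irreducible_factor hu h0
  obtain ⟨q, hq, hfq⟩ := UniqueFactorizationMonoid.exists_mem_factors_of_dvd hP0 hfirr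
    (hfh.trans hhP)
  apply hQ
  simp only [Set.mem_iUnion]
  exact ⟨dvdSub V q, Finset.mem_image.2 ⟨q, Multiset.mem_toFinset.2 hq, rfl⟩,
    hfq.symm.dvd.trans (hfh.trans hhQ)⟩

lemma onC_card (S : Finset P2) (l : Poly3) :
    {x ∈ (S : Set P2) | eval x.rep l = 0}.ncard = (onC S l).card := by
  classical
  rw [← Set.ncard_coe_finset]
  congr 1
  ext x
  simp [mem_onC]

theorem exists_polys_total_weight_ge_three_d_case_m3_eq_ten
    (S : Finset (Projectivization ℂ (Fin 3 → ℂ))) (hS : S.card = 12)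
    (hline : ∀ l : MvPolynomial (Fin 3) ℂ, l ≠ 0 → l.IsHomogeneous 1 →
      {x ∈ (S : Set (Projectivization ℂ (Fin 3 → ℂ))) | eval x.rep l = 0}.ncard ≤ 4)
    (hconic : ∀ c : MvPolynomial (Fin 3) ℂ, c ≠ 0 → c.IsHomogeneous 2 →
      {x ∈ (S : Set (Projectivization ℂ (Fin 3 → ℂ))) | eval x.rep c = 0}.ncard ≤ 7)
    (hcubic : ∀ F : MvPolynomial (Fin 3) ℂ, F ≠ 0 → F.IsHomogeneous 3 →
      {x ∈ (S : Set (Projectivization ℂ (Fin 3 → ℂ))) | eval x.rep F = 0}.ncard ≤ 10)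
    (hirrcubic : ∀ F : MvPolynomial (Fin 3) ℂ, F ≠ 0 → F.IsHomogeneous 3 →
      Irreducible F →
      {x ∈ (S : Set (Projectivization ℂ (Fin 3 → ℂ))) | eval x.rep F = 0}.ncard ≤ 9)
    (hten : ∃ F : MvPolynomial (Fin 3) ℂ, F ≠ 0 ∧ F.IsHomogeneous 3 ∧
      {x ∈ (S : Set (Projectivization ℂ (Fin 3 → ℂ))) | eval x.rep F = 0}.ncard = 10) :
    ∃ d : ℕ, 3 ≤ d ∧ d ≤ 6 ∧
      ∃ P Q : MvPolynomial (Fin 3) ℂ, P ≠ 0 ∧ Q ≠ 0 ∧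
        P.IsHomogeneous d ∧ Q.IsHomogeneous d ∧
        (¬ ∃ h : MvPolynomial (Fin 3) ℂ, 0 < h.totalDegree ∧ h ∣ P ∧ h ∣ Q) ∧
        3 * d ≤ ∑ x ∈ S, min (ordAt P x) (ordAt Q x) := by
  simp only [onC_card] at hline hconic hcubic
  have hdim := formsDim_quartic hS
  obtain ⟨P, hP0, hP⟩ := exists_form (k := 4) (T := S) (by omega)
  obtain ⟨Q, hQ, hPQ⟩ := exists_coprime_pair (V := formsThrough 4 S) (n := 4)
    (fun F hF => hF.1) (mem_formsThrough.2 hP) hP0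
    (fun h e h0 he he1 he4 => no_common_factor hS hline hconic hcubic h0 he he1 he4)
  have hQ0 : Q ≠ 0 := by
    rintro rfl
    refine hPQ ⟨P, ?_, dvd_rfl, dvd_zero P⟩
    rw [hP.1.totalDegree hP0]
    norm_num
  refine ⟨4, by norm_num, by norm_num, P, Q, hP0, hQ0, hP.1, hQ.1, hPQ, ?_⟩
  calc 3 * 4 = ∑ x ∈ S, 1 := by simp [hS]
    _ ≤ _ := Finset.sum_le_sum fun x hx =>
      le_min (one_le_ordAt x 4 P hP0 hP.1 (hP.2 x hx)) (one_le_ordAt x 4 Q hQ0 hQ.1 (hQ.2 x hx))
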